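/- arXiv:1809.01417 — 2 statements merged into one kernel-verified Lean document; each statement's English description precedes it below -/
import Mathlib

section
/- Let S ∈ ℤ and let u, v : (0,∞) → ℝ be differentiable functions satisfying, for all r > 0, u'(r) + ((S+1)/r) u(r) = v(r)(u(r)² + v(r)²) and v'(r) − (S/r) v(r) = −u(r)(u(r)² + v(r)²), together with lim_{r→0⁺} r^{1/2} u(r) = 0 and lim_{r→0⁺} r^{1/2} v(r) = 0. Define U(r) = √(2|2S+1|) · r^S / (r^{2S+1} + r^{-(2S+1)}) and V(r) = √(2|2S+1|) · r^{-S-1} / (r^{2S+1} + r^{-(2S+1)}). Then either u and v are identically zero, or there exist λ > 0 and σ, τ ∈ {+1, −1} with σ = τ if 2S+1 > 0 and σ = −τ if 2S+1 < 0, such that u(r) = σ λ^{-1/2} U(r/λ) and v(r) = τ λ^{-1/2} V(r/λ) for all r > 0. -/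
open Filter Topology

noncomputable section

/-- `U(r) = √(2|2S+1|) · r^S / (r^{2S+1} + r^{-(2S+1)})`. -/
def Uex (S : ℤ) (r : ℝ) : ℝ :=
  Real.sqrt (2 * |2 * (S : ℝ) + 1|) * r ^ S / (r ^ (2 * S + 1) + r ^ (-(2 * S + 1)))

/-- `V(r) = √(2|2S+1|) · r^{-S-1} / (r^{2S+1} + r^{-(2S+1)})`. -/
def Vex (S : ℤ) (r : ℝ) : ℝ :=
  Real.sqrt (2 * |2 * (S : ℝ) + 1|) * r ^ (-S - 1) / (r ^ (2 * S + 1) + r ^ (-(2 * S + 1)))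

/-- A function with vanishing derivative on `(0, ∞)` is constant there. -/
lemma eq_of_hasDerivAt_zero_Ioi {f : ℝ → ℝ} (hf : ∀ r ∈ Set.Ioi (0 : ℝ), HasDerivAt f 0 r)
    {a b : ℝ} (ha : 0 < a) (hb : 0 < b) : f a = f b :=
  isOpen_Ioi.is_const_of_deriv_eq_zero isPreconnected_Ioi
    (fun r hr => (hf r hr).differentiableAt.differentiableWithinAt)
    (fun r hr => (hf r hr).deriv) ha hb

/-- A function with nonnegative derivative on `(0, ∞)` is monotone there. -/
lemma monotoneOn_Ioi_of_hasDerivAt_nonneg {f f' : ℝ → ℝ}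
    (hf : ∀ r ∈ Set.Ioi (0 : ℝ), HasDerivAt f (f' r) r)
    (hf' : ∀ r ∈ Set.Ioi (0 : ℝ), 0 ≤ f' r) : MonotoneOn f (Set.Ioi 0) := by
  refine monotoneOn_of_deriv_nonneg (convex_Ioi 0)
    (fun r hr => (hf r hr).continuousAt.continuousWithinAt) ?_ ?_
  · rw [interior_Ioi]
    exact fun r hr => (hf r hr).differentiableAt.differentiableWithinAt
  · rw [interior_Ioi]
    exact fun r hr => (hf r hr).deriv ▸ hf' r hr

/-- The Hamiltonian of the radial system vanishes for solutions that are `o(r^{-1/2})` at `0`. -/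
lemma hamiltonian_eq_zero (S : ℤ) (u v : ℝ → ℝ)
    (hu : ∀ r ∈ Set.Ioi (0 : ℝ), HasDerivAt u
      (v r * (u r ^ 2 + v r ^ 2) - ((S : ℝ) + 1) / r * u r) r)
    (hv : ∀ r ∈ Set.Ioi (0 : ℝ), HasDerivAt v
      ((S : ℝ) / r * v r - u r * (u r ^ 2 + v r ^ 2)) r)
    (hu0 : Tendsto (fun r : ℝ => r ^ ((1 : ℝ) / 2) * u r) (nhdsWithin 0 (Set.Ioi 0)) (nhds 0))
    (hv0 : Tendsto (fun r : ℝ => r ^ ((1 : ℝ) / 2) * v r) (nhdsWithin 0 (Set.Ioi 0)) (nhds 0))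
    {r : ℝ} (hr : 0 < r) :
    r * (u r ^ 2 + v r ^ 2) ^ 2 = 2 * (2 * (S : ℝ) + 1) * (u r * v r) := by
  set H : ℝ → ℝ := fun r =>
    (r * (u r ^ 2 + v r ^ 2)) ^ 2 - 2 * (2 * (S : ℝ) + 1) * (r * (u r * v r)) with hH
  have hderiv : ∀ s ∈ Set.Ioi (0 : ℝ), HasDerivAt H 0 s := by
    intro s hs
    have hs0 : s ≠ 0 := (Set.mem_Ioi.mp hs).ne'
    have h := (((hasDerivAt_id s).mul (((hu s hs).pow 2).add ((hv s hs).pow 2))).pow 2).sub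
      (((hasDerivAt_id s).mul ((hu s hs).mul (hv s hs))).const_mul (2 * (2 * (S : ℝ) + 1)))
    refine h.congr_deriv ?_
    simp
    field_simp
    ring
  have hlim : Tendsto H (nhdsWithin 0 (Set.Ioi 0)) (nhds 0) := by
    have h := (((hu0.pow 2).add (hv0.pow 2)).pow 2).sub
      ((hu0.mul hv0).const_mul (2 * (2 * (S : ℝ) + 1)))
    norm_num at h
    refine h.congr' ?_
    filter_upwards [self_mem_nhdsWithin] with s hs
    have hsq : (s ^ ((1 : ℝ) / 2)) ^ 2 = s := by
      rw [← Real.sqrt_eq_rpow, Real.sq_sqrt (le_of_lt hs)]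
    simp only [hH]
    norm_num at hsq
    set q := s ^ ((1 : ℝ) / 2)
    rw [← hsq]
    ring
  have hconst : Tendsto H (nhdsWithin 0 (Set.Ioi 0)) (nhds (H r)) := by
    refine tendsto_const_nhds.congr' ?_
    filter_upwards [self_mem_nhdsWithin] with s hs
    exact eq_of_hasDerivAt_zero_Ioi hderiv hr hs
  have hzero : H r = 0 := tendsto_nhds_unique hconst hlim
  simp only [hH] at hzero
  refine mul_left_cancel₀ hr.ne' ?_
  linear_combination hzero

/-- On the zero level set of the Hamiltonian, a solution that vanishes somewhere is trivial. -/
lemma eq_zero_of_eq_zero_at (S : ℤ) (u v : ℝ → ℝ)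
    (hu : ∀ r ∈ Set.Ioi (0 : ℝ), HasDerivAt u
      (v r * (u r ^ 2 + v r ^ 2) - ((S : ℝ) + 1) / r * u r) r)
    (hv : ∀ r ∈ Set.Ioi (0 : ℝ), HasDerivAt v
      ((S : ℝ) / r * v r - u r * (u r ^ 2 + v r ^ 2)) r)
    (hE : ∀ r : ℝ, 0 < r →
      r * (u r ^ 2 + v r ^ 2) ^ 2 = 2 * (2 * (S : ℝ) + 1) * (u r * v r))
    {a : ℝ} (ha : 0 < a) (hua : u a = 0) (hva : v a = 0) {r : ℝ} (hr : 0 < r) :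
    u r = 0 ∧ v r = 0 := by
  set m : ℝ := 2 * (S : ℝ) + 1 with hm
  have hsign : ∀ s : ℝ, 0 < s → 0 ≤ m * (u s * v s) := by
    intro s hs
    have h1 := hE s hs
    have h2 : 0 ≤ s * (u s ^ 2 + v s ^ 2) ^ 2 := by positivity
    linarith
  have hmonoU : MonotoneOn (fun s => m * (u s * s ^ (S + 1)) ^ 2) (Set.Ioi 0) := by
    refine monotoneOn_Ioi_of_hasDerivAt_nonneg
      (f' := fun s => 2 * (s ^ (S + 1)) ^ 2 * (u s ^ 2 + v s ^ 2) * (m * (u s * v s))) ?_ ?_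
    · intro s hs
      have hs0 : s ≠ 0 := (Set.mem_Ioi.mp hs).ne'
      refine ((((hu s hs).mul (hasDerivAt_zpow (S + 1) s (Or.inl hs0))).pow 2).const_mul
        m).congr_deriv ?_
      rw [zpow_sub_one₀ hs0]
      push_cast
      simp only [Pi.mul_apply]
      field_simp
      ring
    · intro s hs
      have := hsign s hs
      positivity
  have hmonoV : MonotoneOn (fun s => -(m * (v s * s ^ (-S)) ^ 2)) (Set.Ioi 0) := by
    refine monotoneOn_Ioi_of_hasDerivAt_nonneg
      (f' := fun s => 2 * (s ^ (-S)) ^ 2 * (u s ^ 2 + v s ^ 2) * (m * (u s * v s))) ?_ ?_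
    · intro s hs
      have hs0 : s ≠ 0 := (Set.mem_Ioi.mp hs).ne'
      refine ((((hv s hs).mul (hasDerivAt_zpow (-S) s (Or.inl hs0))).pow 2).const_mul
        m).neg.congr_deriv ?_
      rw [zpow_sub_one₀ hs0]
      push_cast
      simp only [Pi.mul_apply]
      field_simp
      ring
    · intro s hs
      have := hsign s hs
      positivity
  have hm0 : m ≠ 0 := by
    rw [hm]
    exact_mod_cast (by omega : 2 * S + 1 ≠ 0)
  have huv : u r = 0 ∨ v r = 0 := by
    have hA : 0 < (r ^ (S + 1)) ^ 2 := by positivity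
    have hB : 0 < (r ^ (-S)) ^ 2 := by positivity
    rcases le_total r a with hle | hle
    · have h1 := hmonoU hr ha hle
      have h2 := hmonoV hr ha hle
      simp only [hua, hva, mul_pow] at h1 h2
      rcases hm0.lt_or_gt with hneg | hpos
      · right
        by_contra hne
        have : 0 < v r ^ 2 * (r ^ (-S)) ^ 2 := by positivity
        nlinarith
      · left
        by_contra hne
        have : 0 < u r ^ 2 * (r ^ (S + 1)) ^ 2 := by positivity
        nlinarith
    · have h1 := hmonoU ha hr hle
      have h2 := hmonoV ha hr hle
      simp only [hua, hva, mul_pow] at h1 h2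
      rcases hm0.lt_or_gt with hneg | hpos
      · left
        by_contra hne
        have : 0 < u r ^ 2 * (r ^ (S + 1)) ^ 2 := by positivity
        nlinarith
      · right
        by_contra hne
        have : 0 < v r ^ 2 * (r ^ (-S)) ^ 2 := by positivity
        nlinarith
  have h := hE r hr
  rw [mul_eq_zero.mpr huv, mul_zero] at h
  have h0 : u r ^ 2 + v r ^ 2 = 0 := by simpa [hr.ne'] using h
  constructor <;> nlinarith [sq_nonneg (u r), sq_nonneg (v r)]

/-- On the zero level set of the Hamiltonian, `u / v` is a multiple of `r ^ (2S+1)`. -/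
lemma exists_eq_mul_zpow_mul (S : ℤ) (u v : ℝ → ℝ)
    (hu : ∀ r ∈ Set.Ioi (0 : ℝ), HasDerivAt u
      (v r * (u r ^ 2 + v r ^ 2) - ((S : ℝ) + 1) / r * u r) r)
    (hv : ∀ r ∈ Set.Ioi (0 : ℝ), HasDerivAt v
      ((S : ℝ) / r * v r - u r * (u r ^ 2 + v r ^ 2)) r)
    (hE : ∀ r : ℝ, 0 < r →
      r * (u r ^ 2 + v r ^ 2) ^ 2 = 2 * (2 * (S : ℝ) + 1) * (u r * v r))
    (hv_ne : ∀ r : ℝ, 0 < r → v r ≠ 0) :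
    ∃ C : ℝ, ∀ r : ℝ, 0 < r → u r = C * r ^ (2 * S + 1) * v r := by
  have hderiv : ∀ s ∈ Set.Ioi (0 : ℝ),
      HasDerivAt (fun s => u s / v s * s ^ (-(2 * S + 1))) 0 s := by
    intro s hs
    have hs0 : s ≠ 0 := (Set.mem_Ioi.mp hs).ne'
    have hvs := hv_ne s hs
    refine (((hu s hs).div (hv s hs) hvs).mul
      (hasDerivAt_zpow (-(2 * S + 1)) s (Or.inl hs0))).congr_deriv ?_
    rw [zpow_sub_one₀ hs0]
    push_cast
    simp only [Pi.div_apply]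
    field_simp
    linear_combination s ^ (-(2 * S + 1)) * hE s hs
  refine ⟨u 1 / v 1 * 1 ^ (-(2 * S + 1)), fun r hr => ?_⟩
  have hvr := hv_ne r hr
  have hr0 : r ^ (2 * S + 1) ≠ 0 := zpow_ne_zero _ hr.ne'
  rw [eq_of_hasDerivAt_zero_Ioi hderiv one_pos hr, zpow_neg]
  field_simp

lemma Uex_eq_zpow_mul_Vex (S : ℤ) {s : ℝ} (hs : 0 < s) :
    Uex S s = s ^ (2 * S + 1) * Vex S s := by
  have h : s ^ S = s ^ (2 * S + 1) * s ^ (-S - 1) := by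
    rw [← zpow_add₀ hs.ne']
    congr 1
    ring
  rw [Uex, Vex, h]
  ring

lemma Vex_pos (S : ℤ) {s : ℝ} (hs : 0 < s) : 0 < Vex S s := by
  have hm : (2 * (S : ℝ) + 1) ≠ 0 := by exact_mod_cast (by omega : 2 * S + 1 ≠ 0)
  have : 0 < |2 * (S : ℝ) + 1| := abs_pos.mpr hm
  unfold Vex
  positivity

lemma mul_Vex_sq (S : ℤ) {s : ℝ} (hs : 0 < s) :
    s * (1 + (s ^ (2 * S + 1)) ^ 2) ^ 2 * Vex S s ^ 2 =
      2 * |2 * (S : ℝ) + 1| * s ^ (2 * S + 1) := by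
  have hq : 0 < s ^ (2 * S + 1) := zpow_pos hs _
  have h : s * (s ^ (-S - 1)) ^ 2 = (s ^ (2 * S + 1))⁻¹ := by
    rw [← zpow_neg, ← zpow_natCast, ← zpow_mul, ← zpow_one_add₀ hs.ne']
    congr 1
    push_cast
    ring
  have hsqrt : Real.sqrt (2 * |2 * (S : ℝ) + 1|) ^ 2 = 2 * |2 * (S : ℝ) + 1| :=
    Real.sq_sqrt (by positivity)
  rw [Vex, div_pow, mul_pow, hsqrt, zpow_neg]
  generalize s ^ (2 * S + 1) = q at *
  rw [show s * (1 + q ^ 2) ^ 2 * (2 * |2 * (S : ℝ) + 1| * (s ^ (-S - 1)) ^ 2 / (q + q⁻¹) ^ 2)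
    = (1 + q ^ 2) ^ 2 * (2 * |2 * (S : ℝ) + 1|) * (s * (s ^ (-S - 1)) ^ 2) / (q + q⁻¹) ^ 2 by ring,
    h]
  field_simp
  ring

/-- A continuous nonvanishing function on `(0, ∞)` has constant sign. -/
lemma exists_sign_of_continuousOn_Ioi {f : ℝ → ℝ} (hf : ContinuousOn f (Set.Ioi 0))
    (hne : ∀ r : ℝ, 0 < r → f r ≠ 0) :
    ∃ τ : ℝ, (τ = 1 ∨ τ = -1) ∧ ∀ r : ℝ, 0 < r → 0 < τ * f r := by
  have hcross : ∀ a b : ℝ, 0 < a → 0 < b → f a < 0 → ¬ 0 < f b := by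
    intro a b ha hb hfa hfb
    obtain ⟨c, hc, hc0⟩ := isPreconnected_Ioi.intermediate_value (Set.mem_Ioi.mpr ha)
      (Set.mem_Ioi.mpr hb) hf ⟨hfa.le, hfb.le⟩
    exact hne c hc hc0
  rcases (hne 1 one_pos).lt_or_gt with h | h
  · refine ⟨-1, Or.inr rfl, fun r hr => ?_⟩
    have := (hne r hr).lt_of_le (not_lt.mp (hcross 1 r one_pos hr h))
    linarith
  · refine ⟨1, Or.inl rfl, fun r hr => ?_⟩
    have := (hne r hr).symm.lt_of_le (not_lt.mp fun h' => hcross r 1 hr one_pos h' h)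
    linarith

theorem classification_excited_states_explicit (S : ℤ) (u v : ℝ → ℝ)
    (hu : ∀ r ∈ Set.Ioi (0 : ℝ), HasDerivAt u
      (v r * (u r ^ 2 + v r ^ 2) - ((S : ℝ) + 1) / r * u r) r)
    (hv : ∀ r ∈ Set.Ioi (0 : ℝ), HasDerivAt v
      ((S : ℝ) / r * v r - u r * (u r ^ 2 + v r ^ 2)) r)
    (hu0 : Tendsto (fun r : ℝ => r ^ ((1 : ℝ) / 2) * u r) (nhdsWithin 0 (Set.Ioi 0)) (nhds 0))
    (hv0 : Tendsto (fun r : ℝ => r ^ ((1 : ℝ) / 2) * v r) (nhdsWithin 0 (Set.Ioi 0)) (nhds 0)) :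
    (∀ r ∈ Set.Ioi (0 : ℝ), u r = 0 ∧ v r = 0) ∨
    ∃ lam : ℝ, 0 < lam ∧ ∃ σ τ : ℝ, (σ = 1 ∨ σ = -1) ∧ (τ = 1 ∨ τ = -1) ∧
      (0 < 2 * S + 1 → σ = τ) ∧ (2 * S + 1 < 0 → σ = -τ) ∧
      ∀ r ∈ Set.Ioi (0 : ℝ),
        u r = σ * lam ^ (-(1 : ℝ) / 2) * Uex S (r / lam) ∧
        v r = τ * lam ^ (-(1 : ℝ) / 2) * Vex S (r / lam) := by
  have hE : ∀ r : ℝ, 0 < r →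
      r * (u r ^ 2 + v r ^ 2) ^ 2 = 2 * (2 * (S : ℝ) + 1) * (u r * v r) :=
    fun r hr => hamiltonian_eq_zero S u v hu hv hu0 hv0 hr
  by_cases htriv : ∃ a : ℝ, 0 < a ∧ v a = 0
  · obtain ⟨a, ha, hva⟩ := htriv
    have hua : u a = 0 := by
      have h := hE a ha
      simpa [hva, ha.ne'] using h
    exact Or.inl fun r hr => eq_zero_of_eq_zero_at S u v hu hv hE ha hua hva hr
  right
  push Not at htriv
  obtain ⟨C, hC⟩ := exists_eq_mul_zpow_mul S u v hu hv hE htriv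
  obtain ⟨τ, hτ, hτv⟩ := exists_sign_of_continuousOn_Ioi
    (fun r hr => (hv r hr).continuousAt.continuousWithinAt) htriv
  have hmZ : 2 * S + 1 ≠ 0 := by omega
  have hm0 : 2 * (S : ℝ) + 1 ≠ 0 := by exact_mod_cast hmZ
  have hmC : 0 < (2 * (S : ℝ) + 1) * C := by
    have hv1 := htriv 1 one_pos
    have h1 := hE 1 one_pos
    have hu1 : u 1 = C * v 1 := by simpa using hC 1 one_pos
    have h2 : 0 < v 1 ^ 2 := by positivity
    have h3 : 0 < (u 1 ^ 2 + v 1 ^ 2) ^ 2 := by positivity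
    rw [hu1] at h1 h3
    refine pos_of_mul_pos_left (b := 2 * v 1 ^ 2) ?_ (by positivity)
    linarith
  have hC0 : C ≠ 0 := by
    rintro rfl
    simp at hmC
  obtain ⟨ε, hε, hεm, hεC⟩ : ∃ ε : ℝ, (ε = 1 ∨ ε = -1) ∧
      2 * (S : ℝ) + 1 = ε * |2 * (S : ℝ) + 1| ∧ C = ε * |C| := by
    rcases hm0.lt_or_gt with h | h
    · have hCneg : C < 0 := neg_of_mul_pos_right hmC h.le
      exact ⟨-1, Or.inr rfl, by rw [abs_of_neg h]; ring, by rw [abs_of_neg hCneg]; ring⟩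
    · have hCpos : 0 < C := pos_of_mul_pos_right hmC h.le
      exact ⟨1, Or.inl rfl, by rw [abs_of_pos h]; ring, by rw [abs_of_pos hCpos]; ring⟩
  have hCabs : 0 < |C| := abs_pos.mpr hC0
  obtain ⟨lam, hlam, hlamC⟩ : ∃ lam : ℝ, 0 < lam ∧ lam ^ (2 * S + 1) = |C|⁻¹ := by
    refine ⟨|C|⁻¹ ^ ((2 * (S : ℝ) + 1)⁻¹), by positivity, ?_⟩
    rw [← Real.rpow_intCast, ← Real.rpow_mul (by positivity)]
    push_cast
    rw [inv_mul_cancel₀ hm0, Real.rpow_one]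
  have hε2 : ε * ε = 1 := by rcases hε with rfl | rfl <;> norm_num
  have hτ2 : τ * τ = 1 := by rcases hτ with rfl | rfl <;> norm_num
  have hu_eq : ∀ r : ℝ, 0 < r → u r = ε * (r / lam) ^ (2 * S + 1) * v r := by
    intro r hr
    rw [hC r hr, div_zpow, hlamC, div_inv_eq_mul]
    nth_rewrite 1 [hεC]
    ring
  have hlam2 : (lam ^ (-(1 : ℝ) / 2)) ^ 2 = lam⁻¹ := by
    rw [← Real.rpow_natCast, ← Real.rpow_mul hlam.le]
    norm_num [Real.rpow_neg_one]
  have hv_eq : ∀ r : ℝ, 0 < r → v r = τ * lam ^ (-(1 : ℝ) / 2) * Vex S (r / lam) := by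
    intro r hr
    have hs : 0 < r / lam := div_pos hr hlam
    have hV := Vex_pos S hs
    have hVsq := mul_Vex_sq S hs
    have hEr := hE r hr
    have hvr := htriv r hr
    rw [hu_eq r hr, hεm] at hEr
    have hq : 0 < (r / lam) ^ (2 * S + 1) := zpow_pos hs _
    set q := (r / lam) ^ (2 * S + 1)
    have hvsq : r * (1 + q ^ 2) ^ 2 * v r ^ 2 = 2 * |2 * (S : ℝ) + 1| * q := by
      refine mul_right_cancel₀ (pow_ne_zero 2 hvr) ?_
      have h4 : (ε * q * v r) ^ 2 + v r ^ 2 = (1 + q ^ 2) * v r ^ 2 := by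
        linear_combination q ^ 2 * v r ^ 2 * hε2
      rw [h4] at hEr
      linear_combination hEr + 2 * |2 * (S : ℝ) + 1| * q * v r ^ 2 * hε2
    have hsq : (τ * v r) ^ 2 = (lam ^ (-(1 : ℝ) / 2) * Vex S (r / lam)) ^ 2 := by
      have hfac : r * (1 + q ^ 2) ^ 2 ≠ 0 := by positivity
      refine mul_left_cancel₀ hfac ?_
      rw [mul_pow, mul_pow, hlam2]
      linear_combination hvsq - hVsq + r * (1 + q ^ 2) ^ 2 * v r ^ 2 * hτ2
    have habs := (pow_left_inj₀ (hτv r hr).le (by positivity) two_ne_zero).mp hsq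
    linear_combination τ * habs - v r * hτ2
  refine ⟨lam, hlam, ε * τ, τ, ?_, hτ, ?_, ?_, fun r hr => ⟨?_, hv_eq r hr⟩⟩
  · rcases hε with rfl | rfl <;> rcases hτ with rfl | rfl <;> norm_num
  · intro h
    have hpos : 0 < 2 * (S : ℝ) + 1 := by exact_mod_cast h
    rcases hε with rfl | rfl
    · ring
    · linarith [abs_nonneg (2 * (S : ℝ) + 1)]
  · intro h
    have hneg : 2 * (S : ℝ) + 1 < 0 := by exact_mod_cast h
    rcases hε with rfl | rfl
    · linarith [abs_nonneg (2 * (S : ℝ) + 1)]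
    · ring
  · rw [hu_eq r hr, hv_eq r hr, Uex_eq_zpow_mul_Vex S (div_pos hr hlam)]
    ring
end
end

section
/- Let β₁, β₂ > 0 and S ∈ ℤ, and let f, g : ℝ → ℝ be differentiable functions satisfying, for all t ∈ ℝ, f'(t) + (S + 1/2) f(t) = g(t)(2β₂ f(t)² + β₁ g(t)²) and g'(t) − (S + 1/2) g(t) = −f(t)(β₁ f(t)² + 2β₂ g(t)²), together with lim_{t→−∞} f(t) = 0 and lim_{t→−∞} g(t) = 0. Then there is a constant C < ∞ such that (f(t)² + g(t)²)^{1/2} ≤ C e^{−|S+1/2| |t|} for all t ∈ ℝ. -/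
open Filter Topology

/-- The energy `β₁ (f⁴ + g⁴) / 4 + β₂ f² g² - m f g` is conserved, and it vanishes at `-∞`. -/
lemma energy_eq_zero {β₁ β₂ m : ℝ} {f g : ℝ → ℝ}
    (hf : ∀ t, HasDerivAt f (g t * (2 * β₂ * f t ^ 2 + β₁ * g t ^ 2) - m * f t) t)
    (hg : ∀ t, HasDerivAt g (m * g t - f t * (β₁ * f t ^ 2 + 2 * β₂ * g t ^ 2)) t)
    (hf0 : Tendsto f atBot (𝓝 0)) (hg0 : Tendsto g atBot (𝓝 0)) (t : ℝ) :
    β₁ / 4 * (f t ^ 4 + g t ^ 4) + β₂ * (f t * g t) ^ 2 = m * (f t * g t) := by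
  set H : ℝ → ℝ := fun s ↦
    β₁ / 4 * (f s ^ 4 + g s ^ 4) + β₂ * (f s * g s) ^ 2 - m * (f s * g s) with hH
  have hderiv (s : ℝ) : HasDerivAt H 0 s := by
    refine HasDerivAt.congr_deriv ((((((hf s).pow 4).add ((hg s).pow 4)).const_mul (β₁ / 4)).add
      ((((hf s).mul (hg s)).pow 2).const_mul β₂)).sub (((hf s).mul (hg s)).const_mul m)) ?_
    simp only [Pi.mul_apply]
    push_cast
    ring
  have hconst (s : ℝ) : H s = H t :=
    is_const_of_deriv_eq_zero (fun x ↦ (hderiv x).differentiableAt) (fun x ↦ (hderiv x).deriv) s t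
  have hlim : Tendsto H atBot (𝓝 0) := by
    have := ((((hf0.pow 4).add (hg0.pow 4)).const_mul (β₁ / 4)).add
      (((hf0.mul hg0).pow 2).const_mul β₂)).sub ((hf0.mul hg0).const_mul m)
    simpa using this
  have hzero : H t = 0 :=
    tendsto_nhds_unique (tendsto_const_nhds.congr fun s ↦ (hconst s).symm) hlim
  simp only [hH] at hzero
  linarith

/-- On the zero energy level the product of the two components is bounded. -/
lemma abs_mul_le_of_energy_eq_zero {β₁ β₂ m x y : ℝ} (hβ₁ : 0 < β₁)
    (h : β₁ / 4 * (x ^ 4 + y ^ 4) + β₂ * (x * y) ^ 2 = m * (x * y)) :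
    (β₂ + β₁ / 2) * |x * y| ≤ |m| := by
  rcases eq_or_ne (x * y) 0 with h0 | h0
  · simp [h0]
  · refine le_of_mul_le_mul_right ?_ (abs_pos.mpr h0)
    rw [← abs_mul, ← h, mul_assoc, abs_mul_abs_self]
    refine le_trans ?_ (le_abs_self _)
    nlinarith [mul_nonneg hβ₁.le (sq_nonneg (x ^ 2 - y ^ 2))]

/-- On the zero energy level `(x² + y²)²` is controlled by `|x y|`. -/
lemma sq_le_of_energy_eq_zero {β₁ β₂ m x y : ℝ} (hβ₁ : 0 < β₁) (hβ₂ : 0 < β₂)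
    (h : β₁ / 4 * (x ^ 4 + y ^ 4) + β₂ * (x * y) ^ 2 = m * (x * y)) :
    (x ^ 2 + y ^ 2) ^ 2 ≤ 8 * |m| / β₁ * |x * y| := by
  have hb := abs_mul_le_of_energy_eq_zero hβ₁ h
  have hm : m * (x * y) ≤ |m| * |x * y| := by rw [← abs_mul]; exact le_abs_self _
  have hp : (x * y) ^ 2 = |x * y| ^ 2 := (sq_abs _).symm
  have hq : 0 ≤ |x * y| := abs_nonneg _
  have h1 := mul_le_mul_of_nonneg_right hb hq
  rw [div_mul_eq_mul_div, le_div_iff₀ hβ₁]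
  have h2 : (x ^ 2 + y ^ 2) ^ 2 = x ^ 4 + y ^ 4 + 2 * (x * y) ^ 2 := by ring
  rw [h2, hp]
  rw [hp] at h
  nlinarith [mul_nonneg hβ₂.le (sq_nonneg |x * y|)]

/-- A function whose logarithmic derivative is bounded and which vanishes somewhere is
nonpositive. -/
lemma nonpos_of_abs_deriv_le {ρ ρ' : ℝ → ℝ} {K : ℝ} (hρ : ∀ t, HasDerivAt ρ (ρ' t) t)
    (hK : ∀ t, |ρ' t| ≤ K * ρ t) {s : ℝ} (hs : ρ s = 0) (t : ℝ) : ρ t ≤ 0 := by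
  have hd (k x : ℝ) : HasDerivAt (fun x ↦ ρ x * Real.exp (k * x))
      ((ρ' x + k * ρ x) * Real.exp (k * x)) x := by
    refine HasDerivAt.congr_deriv ((hρ x).mul (((hasDerivAt_id x).const_mul k).exp)) ?_
    simp only [id]
    ring
  rcases le_total t s with hts | hts
  · have hmono : Monotone fun x ↦ ρ x * Real.exp (K * x) :=
      monotone_of_deriv_nonneg (fun x ↦ (hd K x).differentiableAt) fun x ↦ by
        rw [(hd K x).deriv]
        have := (abs_le.mp (hK x)).1
        exact mul_nonneg (by linarith) (Real.exp_pos _).le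
    have := hmono hts
    simp only [hs, zero_mul] at this
    exact nonpos_of_mul_nonpos_left this (Real.exp_pos _)
  · have hanti : Antitone fun x ↦ ρ x * Real.exp (-K * x) :=
      antitone_of_deriv_nonpos (fun x ↦ (hd (-K) x).differentiableAt) fun x ↦ by
        rw [(hd (-K) x).deriv]
        have := (abs_le.mp (hK x)).2
        exact mul_nonpos_of_nonpos_of_nonneg (by linarith) (Real.exp_pos _).le
    have := hanti hts
    simp only [hs, zero_mul] at this
    exact nonpos_of_mul_nonpos_left this (Real.exp_pos _)

/-- A zero-energy solution that vanishes at one point vanishes identically. -/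
lemma sq_add_sq_eq_zero_of_eq_zero {β₁ β₂ m : ℝ} (hβ₁ : 0 < β₁) (hβ₂ : 0 < β₂) {f g : ℝ → ℝ}
    (hf : ∀ t, HasDerivAt f (g t * (2 * β₂ * f t ^ 2 + β₁ * g t ^ 2) - m * f t) t)
    (hg : ∀ t, HasDerivAt g (m * g t - f t * (β₁ * f t ^ 2 + 2 * β₂ * g t ^ 2)) t)
    (hE : ∀ t, β₁ / 4 * (f t ^ 4 + g t ^ 4) + β₂ * (f t * g t) ^ 2 = m * (f t * g t))
    {s : ℝ} (hs : f s ^ 2 + g s ^ 2 = 0) (t : ℝ) : f t ^ 2 + g t ^ 2 = 0 := by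
  refine le_antisymm ?_ (by positivity)
  refine nonpos_of_abs_deriv_le (ρ := fun t ↦ f t ^ 2 + g t ^ 2)
    (ρ' := fun t ↦ 2 * (-m + (2 * β₂ - β₁) * (f t * g t)) * (f t ^ 2 - g t ^ 2))
    (K := 2 * (|m| + 2 * |m|)) (fun x ↦ ?_) (fun x ↦ ?_) hs t
  · refine HasDerivAt.congr_deriv (((hf x).pow 2).add ((hg x).pow 2)) ?_
    push_cast
    ring
  · have hb := abs_mul_le_of_energy_eq_zero hβ₁ (hE x)
    have h1 : |(2 * β₂ - β₁) * (f x * g x)| ≤ 2 * |m| := by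
      rw [abs_mul]
      have : |2 * β₂ - β₁| ≤ 2 * (β₂ + β₁ / 2) := abs_le.mpr ⟨by linarith, by linarith⟩
      nlinarith [abs_nonneg (f x * g x)]
    have h2 : |f x ^ 2 - g x ^ 2| ≤ f x ^ 2 + g x ^ 2 :=
      abs_le.mpr ⟨by nlinarith [sq_nonneg (f x)], by nlinarith [sq_nonneg (g x)]⟩
    have h3 : |-m + (2 * β₂ - β₁) * (f x * g x)| ≤ |m| + 2 * |m| :=
      (abs_add_le _ _).trans (by rw [abs_neg]; linarith)
    rw [abs_mul, abs_mul, abs_two]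
    gcongr

/-- A solution of `u' = k u` is an exponential. -/
lemma eq_mul_exp_of_hasDerivAt {u : ℝ → ℝ} {k : ℝ} (hu : ∀ t, HasDerivAt u (k * u t) t) (t : ℝ) :
    u t = u 0 * Real.exp (k * t) := by
  have hd (x : ℝ) : HasDerivAt (fun x ↦ u x * Real.exp (-(k * x))) 0 x := by
    refine HasDerivAt.congr_deriv ((hu x).mul (((hasDerivAt_id x).const_mul k).fun_neg.exp)) ?_
    simp only [id]
    ring
  have := is_const_of_deriv_eq_zero (fun x ↦ (hd x).differentiableAt) (fun x ↦ (hd x).deriv) t 0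
  simp only [mul_zero, neg_zero, Real.exp_zero, mul_one] at this
  rw [← this, mul_assoc, ← Real.exp_add]
  simp

/-- For a nowhere vanishing zero-energy solution, `m / (f g) - β₂` is a positive combination of
`exp (4 m t)` and `exp (-4 m t)`, so `f g` decays exponentially. -/
lemma exists_abs_mul_le_exp {β₁ β₂ m : ℝ} (hβ₁ : 0 < β₁) (hβ₂ : 0 < β₂) {f g : ℝ → ℝ}
    (hf : ∀ t, HasDerivAt f (g t * (2 * β₂ * f t ^ 2 + β₁ * g t ^ 2) - m * f t) t)
    (hg : ∀ t, HasDerivAt g (m * g t - f t * (β₁ * f t ^ 2 + 2 * β₂ * g t ^ 2)) t)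
    (hE : ∀ t, β₁ / 4 * (f t ^ 4 + g t ^ 4) + β₂ * (f t * g t) ^ 2 = m * (f t * g t))
    (hne : ∀ t, f t * g t ≠ 0) :
    ∃ C, ∀ t, |f t * g t| ≤ C * Real.exp (-(4 * |m| * |t|)) := by
  set Y : ℝ → ℝ := fun t ↦ m / (f t * g t) - β₂ with hY
  set V : ℝ → ℝ := fun t ↦ β₁ * (f t ^ 4 - g t ^ 4) / (4 * (f t * g t) ^ 2) with hV
  have hY' (t : ℝ) : HasDerivAt Y (4 * m * V t) t := by
    have hp := hne t
    have hft := left_ne_zero_of_mul hp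
    have hgt := right_ne_zero_of_mul hp
    refine HasDerivAt.congr_deriv
      (((hasDerivAt_const t m).div ((hf t).mul (hg t)) hp).sub_const β₂) ?_
    simp only [hV, Pi.mul_apply]
    field_simp
    ring
  have hV' (t : ℝ) : HasDerivAt V (4 * m * Y t) t := by
    have hp := hne t
    have hft := left_ne_zero_of_mul hp
    have hgt := right_ne_zero_of_mul hp
    have hp2 : 4 * (f t * g t) ^ 2 ≠ 0 := by positivity
    refine HasDerivAt.congr_deriv (((((hf t).pow 4).sub ((hg t).pow 4)).const_mul β₁).div
      ((((hf t).mul (hg t)).pow 2).const_mul 4) hp2) ?_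
    simp only [hY, Pi.mul_apply, Pi.sub_apply, Pi.pow_apply]
    push_cast
    field_simp
    linear_combination (16 * m * (f t * g t) + 8 * β₁ * (f t ^ 4 + g t ^ 4)) * hE t
  have hYV (t : ℝ) : (Y t + V t) * (Y t - V t) = β₁ ^ 2 / 4 := by
    have hp := hne t
    have hft := left_ne_zero_of_mul hp
    have hgt := right_ne_zero_of_mul hp
    have h := hE t
    simp only [hY, hV]
    field_simp
    linear_combination (-4) * (4 * (f t * g t) * (m - f t * g t * β₂)
      + β₁ * (f t ^ 4 + g t ^ 4)) * h
  have hYpos (t : ℝ) : 0 < Y t := by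
    have hb := abs_mul_le_of_energy_eq_zero hβ₁ (hE t)
    have hp := abs_pos.mpr (hne t)
    have hmp : 0 ≤ m * (f t * g t) := by rw [← hE t]; positivity
    have hdiv : m / (f t * g t) = |m| / |f t * g t| := by
      rw [← abs_div, abs_of_nonneg]
      rw [← mul_div_mul_right _ _ (hne t)]
      exact div_nonneg hmp (mul_self_nonneg _)
    have : β₂ + β₁ / 2 ≤ m / (f t * g t) := by rwa [hdiv, le_div_iff₀ hp]
    simp only [hY]
    linarith
  have hU := eq_mul_exp_of_hasDerivAt (u := fun t ↦ Y t + V t) (k := 4 * m) fun t ↦ by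
    refine HasDerivAt.congr_deriv ((hY' t).add (hV' t)) ?_
    ring
  have hW := eq_mul_exp_of_hasDerivAt (u := fun t ↦ Y t - V t) (k := -(4 * m)) fun t ↦ by
    refine HasDerivAt.congr_deriv ((hY' t).sub (hV' t)) ?_
    ring
  set a := Y 0 + V 0
  set b := Y 0 - V 0
  have hab : 0 < a * b := by rw [hYV 0]; positivity
  have hsum : 0 < a + b := by linarith [hYpos 0]
  have ha : 0 < a := by
    by_contra! ha
    nlinarith [mul_nonneg_of_nonpos_of_nonpos ha (by nlinarith : b ≤ 0)]
  have hb : 0 < b := pos_of_mul_pos_right hab ha.le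
  have hc : 0 < min a b := lt_min ha hb
  refine ⟨2 * |m| / min a b, fun t ↦ ?_⟩
  have hlow : min a b * Real.exp (4 * |m| * |t|) ≤ 2 * Y t := by
    have hY2 : 2 * Y t = a * Real.exp (4 * m * t) + b * Real.exp (-(4 * m) * t) := by
      rw [← hU, ← hW]; ring
    rw [hY2, mul_assoc, ← abs_mul]
    have e1 := Real.exp_pos (4 * m * t)
    have e2 := Real.exp_pos (-(4 * m) * t)
    rcases abs_choice (m * t) with h | h
    · rw [h, ← mul_assoc]
      nlinarith [min_le_left a b, mul_pos hb e2]
    · rw [h, show 4 * -(m * t) = -(4 * m) * t by ring]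
      nlinarith [min_le_right a b, mul_pos ha e1]
  have hp := abs_pos.mpr (hne t)
  have hle : Y t * |f t * g t| ≤ |m| := by
    have : Y t ≤ |m| / |f t * g t| := by
      rw [← abs_div]
      exact le_trans (by simp only [hY]; linarith) (le_abs_self _)
    rwa [le_div_iff₀ hp] at this
  rw [Real.exp_neg, ← div_eq_mul_inv, div_div, le_div_iff₀ (by positivity)]
  nlinarith

theorem exponential_decay_excited (β₁ β₂ : ℝ) (hβ₁ : 0 < β₁) (hβ₂ : 0 < β₂) (S : ℤ)
    (f g : ℝ → ℝ)
    (hf : ∀ t : ℝ, HasDerivAt f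
      (g t * (2 * β₂ * f t ^ 2 + β₁ * g t ^ 2) - ((S : ℝ) + 1 / 2) * f t) t)
    (hg : ∀ t : ℝ, HasDerivAt g
      (((S : ℝ) + 1 / 2) * g t - f t * (β₁ * f t ^ 2 + 2 * β₂ * g t ^ 2)) t)
    (hf0 : Tendsto f atBot (nhds 0))
    (hg0 : Tendsto g atBot (nhds 0)) :
    ∃ C : ℝ, ∀ t : ℝ,
      (f t ^ 2 + g t ^ 2) ^ ((1 : ℝ) / 2) ≤ C * Real.exp (-|(S : ℝ) + 1 / 2| * |t|) := by
  generalize (S : ℝ) + 1 / 2 = m at hf hg ⊢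
  have hE := energy_eq_zero hf hg hf0 hg0
  by_cases hne : ∀ t, f t * g t ≠ 0
  · obtain ⟨C, hC⟩ := exists_abs_mul_le_exp hβ₁ hβ₂ hf hg hE hne
    have hK : 0 ≤ 8 * |m| / β₁ * C := by
      refine mul_nonneg (by positivity) ?_
      exact nonneg_of_mul_nonneg_left ((abs_nonneg _).trans (hC 0)) (Real.exp_pos _)
    refine ⟨√√(8 * |m| / β₁ * C), fun t ↦ ?_⟩
    rw [← Real.sqrt_eq_rpow]
    refine Real.sqrt_le_iff.mpr ⟨by positivity, ?_⟩
    refine abs_le_of_sq_le_sq' ?_ (by positivity) |>.2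
    calc (f t ^ 2 + g t ^ 2) ^ 2 ≤ 8 * |m| / β₁ * |f t * g t| :=
          sq_le_of_energy_eq_zero hβ₁ hβ₂ (hE t)
      _ ≤ 8 * |m| / β₁ * (C * Real.exp (-(4 * |m| * |t|))) := by gcongr; exact hC t
      _ = ((√√(8 * |m| / β₁ * C) * Real.exp (-|m| * |t|)) ^ 2) ^ 2 := by
          rw [mul_pow, Real.sq_sqrt (Real.sqrt_nonneg _), mul_pow, Real.sq_sqrt hK, ← pow_mul,
            ← Real.exp_nat_mul, ← mul_assoc]
          congr 2
          push_cast
          ring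
  · push Not at hne
    obtain ⟨s, hs⟩ := hne
    have hs0 : f s ^ 2 + g s ^ 2 = 0 := by
      have h := sq_le_of_energy_eq_zero hβ₁ hβ₂ (hE s)
      rw [hs, abs_zero, mul_zero] at h
      exact pow_eq_zero_iff two_ne_zero |>.mp (le_antisymm h (sq_nonneg _))
    refine ⟨0, fun t ↦ ?_⟩
    rw [sq_add_sq_eq_zero_of_eq_zero hβ₁ hβ₂ hf hg hE hs0 t]
    norm_num
end
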